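/- arXiv:1612.07569 — 4 statements merged into one kernel-verified Lean document; each statement's English description precedes it below -/
import Mathlib

section
/- Let F be a field of characteristic zero, V a finite-dimensional F-vector space, f : V → V an F-linear endomorphism, and N a nonzero integer. If for every positive integer k the product N · tr(f^k) is the image of an integer under the canonical map ℤ → F (i.e., every power of f has trace in N⁻¹ℤ), then every coefficient of the characteristic polynomial of f is the image of an integer under ℤ → F (i.e., the characteristic polynomial of f has integer coefficients). -/
namespace Matrix

/-- The determinant of a polynomial in a matrix `A` is the product of its values at the roots of
the characteristic polynomial of `A`. -/
theorem det_aeval_eq_prod_roots_charpoly {K n : Type*} [Field K] [IsAlgClosed K] [Fintype n]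
    [DecidableEq n] (A : Matrix n n K) (p : Polynomial K) :
    (Polynomial.aeval A p).det = (A.charpoly.roots.map p.eval).prod := by
  have hcard : A.charpoly.roots.card = Fintype.card n := by
    rw [← (IsAlgClosed.splits A.charpoly).natDegree_eq_card_roots, charpoly_natDegree_eq_dim]
  have hlin (c : K) : (scalar n c - A).det = (A.charpoly.roots.map (c - ·)).prod := by
    rw [← eval_charpoly, (IsAlgClosed.splits A.charpoly).eval_eq_prod_roots_of_monic
      A.charpoly_monic]
  induction IsAlgClosed.splits p using Submonoid.closure_induction with
  | mem q hq =>
    rcases hq with ⟨c, rfl⟩ | ⟨c, rfl⟩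
    · simp [hcard, Algebra.algebraMap_eq_smul_one]
    · have h : Polynomial.aeval A (Polynomial.X + Polynomial.C c) = -(scalar n (-c) - A) := by
        rw [map_neg, neg_sub, sub_neg_eq_add]
        simp [Algebra.algebraMap_eq_smul_one, smul_one_eq_diagonal]
      rw [h, det_neg, hlin, ← hcard, ← Multiset.card_map (-c - ·) A.charpoly.roots,
        ← Multiset.prod_map_neg, Multiset.map_map]
      simp [add_comm]
  | one => simp
  | mul p q _ _ hp hq => simp [hp, hq]

/-- Over an algebraically closed field, the trace of `A ^ k` is the `k`-th power sum of the roots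
of the characteristic polynomial of `A`. -/
theorem trace_pow_eq_sum_roots_charpoly {K n : Type*} [Field K] [IsAlgClosed K] [Fintype n]
    [DecidableEq n] (A : Matrix n n K) (k : ℕ) :
    (A ^ k).trace = (A.charpoly.roots.map (· ^ k)).sum := by
  have h : (A ^ k).charpoly =
      ((A.charpoly.roots.map (· ^ k)).map fun a ↦ Polynomial.X - Polynomial.C a).prod := by
    have : Infinite K := IsAlgClosed.instInfinite
    refine Polynomial.funext fun x ↦ ?_
    have := det_aeval_eq_prod_roots_charpoly A (Polynomial.C x - Polynomial.X ^ k)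
    rw [eval_charpoly, Polynomial.eval_multiset_prod]
    simpa [Algebra.algebraMap_eq_smul_one, smul_one_eq_diagonal] using this
  rw [trace_eq_sum_roots_charpoly, h, Polynomial.roots_multiset_prod_X_sub_C]

end Matrix

/-- An element all of whose powers lie in a common finitely generated module over a Noetherian
ring is integral. -/
theorem isIntegral_of_forall_pow_mem_fg {R S : Type*} [CommRing R] [IsNoetherianRing R]
    [CommRing S] [Algebra R S] {x : S} (M : Submodule R S) (hM : M.FG)
    (h : ∀ k : ℕ, x ^ k ∈ M) : IsIntegral R x := by
  have hle : (Algebra.adjoin R {x}).toSubmodule ≤ M := by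
    rw [Algebra.adjoin_eq_span, ← Submonoid.powers_eq_closure, Submodule.span_le]
    rintro _ ⟨k, rfl⟩
    exact h k
  have : IsNoetherian R M := isNoetherian_of_fg_of_noetherian M hM
  exact isIntegral_of_submodule_noetherian _ (isNoetherian_of_le hle) x
    (Algebra.self_mem_adjoin_singleton R x)

namespace Multiset

/-- If the power sums of a multiset in a field of characteristic zero have a bounded denominator
`N`, then all its elements are integral over `ℤ`. -/
theorem isIntegral_of_sum_pow {K : Type*} [Field K] [CharZero K] (s : Multiset K) {N : ℤ}
    (hN : N ≠ 0) (h : ∀ k : ℕ, ∃ n : ℤ, (N : K) * (s.map (· ^ k)).sum = n) {x : K}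
    (hx : x ∈ s) : IsIntegral ℤ x := by
  classical
  let p : Polynomial K := ∏ y ∈ s.toFinset.erase x, (Polynomial.X - Polynomial.C y)
  have hpx : p.eval x ≠ 0 := by
    simp only [p, Polynomial.eval_prod, Finset.prod_ne_zero_iff, Polynomial.eval_sub,
      Polynomial.eval_X, Polynomial.eval_C, sub_ne_zero]
    exact fun y hy ↦ (Finset.ne_of_mem_erase hy).symm
  have hp {y : K} (hy : y ∈ s) (hyx : y ≠ x) : p.eval y = 0 := by
    simp only [p, Polynomial.eval_prod]
    exact Finset.prod_eq_zero (Finset.mem_erase.2 ⟨hyx, mem_toFinset.2 hy⟩) (by simp)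
  let c : K := N * (s.count x * p.eval x)
  have hc : c ≠ 0 := by
    have := (count_pos.2 hx).ne'
    simp [c, hN, hpx, this]
  have hsum (k : ℕ) : (s.map fun y ↦ p.eval y * y ^ k).sum = s.count x * p.eval x * x ^ k := by
    rw [Finset.sum_multiset_map_count, Finset.sum_eq_single_of_mem x (mem_toFinset.2 hx)]
    · simp [mul_assoc]
    · intro y hy hyx
      simp [hp (mem_toFinset.1 hy) hyx]
  have hsum' (k : ℕ) : (s.map fun y ↦ p.eval y * y ^ k).sum =
      ∑ j ∈ Finset.range (p.natDegree + 1), p.coeff j * (s.map (· ^ (j + k))).sum := by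
    simp_rw [Polynomial.eval_eq_sum_range, Finset.sum_mul, Multiset.sum_map_sum,
      ← Multiset.sum_map_mul_left, pow_add, mul_assoc]
  refine isIntegral_of_forall_pow_mem_fg
    (Submodule.span ℤ ((Finset.range (p.natDegree + 1)).image fun j ↦ c⁻¹ * p.coeff j : Finset K))
    ⟨_, rfl⟩ fun k ↦ ?_
  have hk : x ^ k = ∑ j ∈ Finset.range (p.natDegree + 1),
      c⁻¹ * p.coeff j * (N * (s.map (· ^ (j + k))).sum) := by
    have : c * x ^ k = N * ∑ j ∈ Finset.range (p.natDegree + 1),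
        p.coeff j * (s.map (· ^ (j + k))).sum := by
      rw [← hsum', hsum]; ring
    rw [(eq_inv_mul_iff_mul_eq₀ hc).2 this, Finset.mul_sum, Finset.mul_sum]
    exact Finset.sum_congr rfl fun j _ ↦ by ring
  rw [hk]
  refine Submodule.sum_mem _ fun j hj ↦ ?_
  obtain ⟨n, hn⟩ := h (j + k)
  rw [hn, mul_comm, ← zsmul_eq_mul]
  exact Submodule.smul_mem _ n (Submodule.subset_span (Finset.mem_image_of_mem _ hj))

/-- Elementary symmetric functions of elements of a subring lie in that subring. -/
theorem esymm_mem {R : Type*} [CommRing R] (S : Subring R) {s : Multiset R}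
    (h : ∀ x ∈ s, x ∈ S) (k : ℕ) : s.esymm k ∈ S := by
  refine S.multiset_sum_mem _ fun y hy ↦ ?_
  obtain ⟨t, ht, rfl⟩ := mem_map.1 hy
  exact S.multiset_prod_mem _ fun x hx ↦ h x (mem_of_le (mem_powersetCard.1 ht).1 hx)

/-- In characteristic zero, a subfield containing the power sums of a multiset contains its
elementary symmetric functions. -/
theorem esymm_mem_of_sum_pow_mem {K : Type*} [Field K] [CharZero K] (L : Subfield K)
    (s : Multiset K) (h : ∀ k : ℕ, (s.map (· ^ k)).sum ∈ L) (k : ℕ) : s.esymm k ∈ L := by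
  classical
  let a : s → K := fun x ↦ x.1
  have ha : (Finset.univ.val.map a) = s := map_univ_coe s
  induction k using Nat.strong_induction_on with | h k ih => ?_
  rcases eq_or_ne k 0 with rfl | hk
  · simp [esymm]
  have hpsum (j : ℕ) : MvPolynomial.aeval a (MvPolynomial.psum s K j) = (s.map (· ^ j)).sum := by
    conv_rhs => rw [← ha, map_map]
    simp only [MvPolynomial.psum, map_sum, map_pow, MvPolynomial.aeval_X]
    rfl
  have hesymm (j : ℕ) : MvPolynomial.aeval a (MvPolynomial.esymm s K j) = s.esymm j := by
    rw [MvPolynomial.aeval_esymm_eq_multiset_esymm, ha]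
  have newton := congrArg (MvPolynomial.aeval a) (MvPolynomial.mul_esymm_eq_sum s K k)
  simp only [map_mul, map_natCast, map_pow, map_neg, map_one, map_sum, hpsum, hesymm] at newton
  rw [(eq_inv_mul_iff_mul_eq₀ (Nat.cast_ne_zero.2 hk)).2 newton]
  have hneg (j : ℕ) : (-1 : K) ^ j ∈ L := pow_mem (neg_mem (one_mem L)) j
  refine mul_mem (inv_mem (natCast_mem L k)) (mul_mem (hneg _) (sum_mem fun i hi ↦ ?_))
  exact mul_mem (mul_mem (hneg _) (ih _ (Finset.mem_filter.1 hi).2)) (h _)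

end Multiset

/-- An element of a field of characteristic zero that is rational and integral over `ℤ` is an
integer. -/
theorem exists_int_eq_of_mem_fieldRange_of_isIntegral {K : Type*} [Field K] [CharZero K] {x : K}
    (hx : x ∈ (algebraMap ℚ K).fieldRange) (hint : IsIntegral ℤ x) : ∃ n : ℤ, x = n := by
  obtain ⟨q, rfl⟩ := hx
  rw [isIntegral_algebraMap_iff (algebraMap ℚ K).injective] at hint
  obtain ⟨n, rfl⟩ := IsIntegrallyClosed.isIntegral_iff.1 hint
  exact ⟨n, by simp⟩

/-- **Lemma (Kleiman).** Let `F` be a field of characteristic zero, `V` a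
finite-dimensional `F`-vector space, `f : V → V` an `F`-linear endomorphism and `N` a nonzero
integer. If every power of `f` has trace in `N⁻¹ℤ`, then the characteristic polynomial of `f`
has integer coefficients. -/
theorem charpoly_coeff_int_of_trace_pow
    (F : Type*) [Field F] [CharZero F]
    (V : Type*) [AddCommGroup V] [Module F V] [FiniteDimensional F V]
    (f : V →ₗ[F] V) (N : ℤ) (hN : N ≠ 0)
    (h : ∀ k : ℕ, 1 ≤ k → ∃ n : ℤ, (N : F) * LinearMap.trace F V (f ^ k) = (n : F)) :
    ∀ i : ℕ, ∃ n : ℤ, (LinearMap.charpoly f).coeff i = (n : F) := by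
  let b := Module.finBasis F V
  let A : Matrix _ _ (AlgebraicClosure F) :=
    (LinearMap.toMatrix b b f).map (algebraMap F (AlgebraicClosure F))
  have hA : A.charpoly = f.charpoly.map (algebraMap F (AlgebraicClosure F)) := by
    rw [← LinearMap.charpoly_toMatrix f b]
    exact Matrix.charpoly_map _ _
  have hcard : A.charpoly.roots.card = A.charpoly.natDegree :=
    (IsAlgClosed.splits A.charpoly).natDegree_eq_card_roots.symm
  have htrace (k : ℕ) :
      (A.charpoly.roots.map (· ^ k)).sum =
        algebraMap F (AlgebraicClosure F) (LinearMap.trace F V (f ^ k)) := by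
    rw [← Matrix.trace_pow_eq_sum_roots_charpoly, LinearMap.trace_eq_matrix_trace F b,
      ← LinearMap.toMatrix_pow, AddMonoidHom.map_trace, ← Matrix.map_pow]
  have hsum (k : ℕ) : ∃ n : ℤ,
      (N : AlgebraicClosure F) * (A.charpoly.roots.map (· ^ k)).sum = n := by
    rcases Nat.eq_zero_or_pos k with rfl | hk
    · exact ⟨N * A.charpoly.roots.card, by simp⟩
    · obtain ⟨n, hn⟩ := h k hk
      exact ⟨n, by rw [htrace]; simpa using congrArg (algebraMap F (AlgebraicClosure F)) hn⟩
  intro i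
  rcases lt_or_ge f.charpoly.natDegree i with hi | hi
  · exact ⟨0, by simp [Polynomial.coeff_eq_zero_of_natDegree_lt hi]⟩
  have hi' : i ≤ A.charpoly.natDegree := by rwa [hA, Polynomial.natDegree_map]
  obtain ⟨n, hn⟩ : ∃ n : ℤ, A.charpoly.roots.esymm (A.charpoly.natDegree - i) = n := by
    refine exists_int_eq_of_mem_fieldRange_of_isIntegral
      (Multiset.esymm_mem_of_sum_pow_mem _ _ (fun k ↦ ?_) _)
      (Multiset.esymm_mem (integralClosure ℤ (AlgebraicClosure F)).toSubring
        (fun x hx ↦ Multiset.isIntegral_of_sum_pow _ hN hsum hx) _)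
    obtain ⟨n, hn⟩ := hsum k
    rw [(eq_inv_mul_iff_mul_eq₀ (Int.cast_ne_zero.2 hN)).2 hn]
    exact mul_mem (inv_mem (intCast_mem _ N)) (intCast_mem _ n)
  refine ⟨(-1) ^ (A.charpoly.natDegree - i) * n, (algebraMap F (AlgebraicClosure F)).injective ?_⟩
  rw [← Polynomial.coeff_map, ← hA, Polynomial.coeff_eq_esymm_roots_of_card hcard hi', hn,
    A.charpoly_monic.leadingCoeff]
  simp
end

section
/- Let F be a field, V a finite-dimensional F-vector space, and N : V → V a nilpotent F-linear endomorphism. Define, for each integer r, the subspace M_r := Σ_{p,q ≥ 0, p − q = r} (Ker N^{p+1} ∩ Im N^{q}) of V. Then (M_r)_{r∈ℤ} is a monodromy filtration for N; that is: M_r ⊆ M_{r+1} for all r; M_r = 0 for all sufficiently small r and M_r = V for all sufficiently large r; N(M_r) ⊆ M_{r−2} for all r; and for every integer r ≥ 0, N^r maps M_r into M_{−r} and the induced F-linear map M_r/M_{r−1} → M_{−r}/M_{−r−1} is an isomorphism. -/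
namespace LinearMap

variable {F V : Type*} [Field F] [AddCommGroup V] [Module F V]

/-- The sum of the subspaces `Ker N^(p+1) ∩ Im N^q` over all `p, q ≥ 0` with `p - q = r`. -/
def sumKerInfRange (N : V →ₗ[F] V) (r : ℤ) : Submodule F V :=
  ⨆ (p : ℕ) (q : ℕ) (_ : (p : ℤ) - (q : ℤ) = r), (ker (N ^ (p + 1)) ⊓ range (N ^ q))

variable {N : V →ₗ[F] V}

theorem sumKerInfRange_le_iff {r : ℤ} {S : Submodule F V} :
    sumKerInfRange N r ≤ S ↔
      ∀ p q : ℕ, (p : ℤ) - q = r → ∀ z, (N ^ (p + 1 + q)) z = 0 → (N ^ q) z ∈ S := by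
  simp only [sumKerInfRange, iSup_le_iff]
  refine forall₃_congr fun p q _ => ⟨fun h z hz => h ⟨?_, z, rfl⟩, ?_⟩
  · rwa [SetLike.mem_coe, mem_ker, ← Module.End.mul_apply, ← pow_add]
  · rintro h _ ⟨hx, z, rfl⟩
    rw [SetLike.mem_coe, mem_ker, ← Module.End.mul_apply, ← pow_add] at hx
    exact h z hx

theorem pow_apply_mem_sumKerInfRange {r : ℤ} {p q : ℕ} (h : (p : ℤ) - q = r) {z : V}
    (hz : (N ^ (p + 1 + q)) z = 0) : (N ^ q) z ∈ sumKerInfRange N r :=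
  sumKerInfRange_le_iff.1 le_rfl p q h z hz

theorem sumKerInfRange_le_succ (r : ℤ) : sumKerInfRange N r ≤ sumKerInfRange N (r + 1) :=
  sumKerInfRange_le_iff.2 fun p q h _ hz =>
    pow_apply_mem_sumKerInfRange (p := p + 1) (by push_cast; lia)
      (Module.End.pow_map_zero_of_le (by lia) hz)

theorem apply_mem_sumKerInfRange {r : ℤ} {x : V} (hx : x ∈ sumKerInfRange N r) :
    N x ∈ sumKerInfRange N (r - 2) := by
  suffices sumKerInfRange N r ≤ (sumKerInfRange N (r - 2)).comap N from this hx
  refine sumKerInfRange_le_iff.2 fun p q h z hz => ?_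
  rw [Submodule.mem_comap, ← Module.End.mul_apply, ← pow_succ']
  cases p with
  | zero =>
    rw [show q + 1 = 0 + 1 + q by lia, hz]
    exact zero_mem _
  | succ p =>
    refine pow_apply_mem_sumKerInfRange (p := p) (by push_cast at h ⊢; lia) ?_
    rwa [show p + 1 + (q + 1) = p + 1 + 1 + q by lia]

theorem pow_apply_mem_sumKerInfRange_sub {r : ℤ} {x : V} (hx : x ∈ sumKerInfRange N r) (n : ℕ) :
    (N ^ n) x ∈ sumKerInfRange N (r - 2 * n) := by
  induction n with
  | zero => simpa using hx
  | succ n ih =>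
    rw [pow_succ', Module.End.mul_apply]
    convert apply_mem_sumKerInfRange ih using 2
    push_cast
    ring

theorem sumKerInfRange_neg_le_map (r : ℕ) :
    sumKerInfRange N (-r) ≤ (sumKerInfRange N r).map (N ^ r) := by
  refine sumKerInfRange_le_iff.2 fun p q h z hz => ⟨(N ^ p) z, ?_, ?_⟩
  · refine pow_apply_mem_sumKerInfRange (p := q) (by lia) ?_
    rwa [show q + 1 + p = p + 1 + q by lia]
  · rw [← Module.End.mul_apply, ← pow_add, show r + p = q by lia]

theorem mem_sumKerInfRange_of_pow_apply_eq_zero {r : ℕ} {x : V} (hx : (N ^ r) x = 0) :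
    x ∈ sumKerInfRange N (r - 1) := by
  cases r with
  | zero =>
    rw [show x = 0 by simpa using hx]
    exact zero_mem _
  | succ r =>
    exact pow_apply_mem_sumKerInfRange (p := r) (q := 0) (by push_cast; ring) hx

theorem mem_sumKerInfRange_of_pow_apply_mem {r : ℕ} {x : V}
    (hx : (N ^ r) x ∈ sumKerInfRange N (-r - 1)) : x ∈ sumKerInfRange N (r - 1) := by
  rw [show (-r - 1 : ℤ) = -((r + 1 : ℕ) : ℤ) by push_cast; ring] at hx
  obtain ⟨w, hw, hwx⟩ := sumKerInfRange_neg_le_map (r + 1) hx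
  have hNw : N w ∈ sumKerInfRange N (r - 1) := by
    convert apply_mem_sumKerInfRange hw using 2
    push_cast
    ring
  rw [← sub_add_cancel x (N w)]
  refine add_mem (mem_sumKerInfRange_of_pow_apply_eq_zero ?_) hNw
  rw [map_sub, ← hwx, pow_succ, Module.End.mul_apply, sub_self]

theorem sumKerInfRange_eq_bot {n : ℕ} (hn : N ^ n = 0) {r : ℤ} (hr : r ≤ -n) :
    sumKerInfRange N r = ⊥ := by
  refine le_bot_iff.1 (sumKerInfRange_le_iff.2 fun p q h z _ => ?_)
  rw [pow_eq_zero_of_le (show n ≤ q by lia) hn]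
  exact zero_mem _

theorem sumKerInfRange_eq_top {n : ℕ} (hn : N ^ n = 0) {r : ℤ} (hr : n ≤ r) :
    sumKerInfRange N r = ⊤ := by
  lift r to ℕ using by lia
  refine eq_top_iff.2 fun x _ => ?_
  refine pow_apply_mem_sumKerInfRange (p := r) (q := 0) (by simp) ?_
  rw [pow_eq_zero_of_le (by lia) hn, zero_apply]

end LinearMap


/-- A family `M : ℤ → Submodule F V` is a *monodromy filtration* for a nilpotent endomorphism
`N : V → V` if it is increasing, exhaustive and separated, satisfies `N (M r) ⊆ M (r - 2)`, and
for every `r ≥ 0` the `r`-th power `N ^ r` maps `M r` into `M (-r)` and induces an isomorphism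
`M r / M (r - 1) ≃ M (-r) / M (-r - 1)` (expressed elementwise: the induced map is injective and
surjective on the quotients). -/
def IsMonodromyFiltration {F V : Type*} [Field F] [AddCommGroup V] [Module F V]
    (N : V →ₗ[F] V) (M : ℤ → Submodule F V) : Prop :=
  (∀ r : ℤ, M r ≤ M (r + 1)) ∧
  (∃ a : ℤ, ∀ r : ℤ, r ≤ a → M r = ⊥) ∧
  (∃ b : ℤ, ∀ r : ℤ, b ≤ r → M r = ⊤) ∧
  (∀ r : ℤ, ∀ x ∈ M r, N x ∈ M (r - 2)) ∧
  (∀ r : ℕ,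
    (∀ x ∈ M (r : ℤ), (N ^ r) x ∈ M (-(r : ℤ))) ∧
    (∀ x ∈ M (r : ℤ), (N ^ r) x ∈ M (-(r : ℤ) - 1) → x ∈ M ((r : ℤ) - 1)) ∧
    (∀ y ∈ M (-(r : ℤ)), ∃ x ∈ M (r : ℤ), (N ^ r) x - y ∈ M (-(r : ℤ) - 1)))

/-- **Existence of the monodromy filtration.** For a nilpotent endomorphism `N` of a
finite-dimensional vector space `V`, the family
`M r = Σ_{p - q = r} (Ker N^(p+1) ∩ Im N^q)` is a monodromy filtration for `N`. -/
theorem isMonodromyFiltration_sum_ker_inf_range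
    (F V : Type*) [Field F] [AddCommGroup V] [Module F V] [FiniteDimensional F V]
    (N : V →ₗ[F] V) (hN : IsNilpotent N) :
    IsMonodromyFiltration N (fun r : ℤ =>
      ⨆ (p : ℕ) (q : ℕ) (_ : (p : ℤ) - (q : ℤ) = r),
        (LinearMap.ker (N ^ (p + 1)) ⊓ LinearMap.range (N ^ q))) := by
  change IsMonodromyFiltration N N.sumKerInfRange
  obtain ⟨n, hn⟩ := hN
  refine ⟨LinearMap.sumKerInfRange_le_succ, ⟨-n, fun _ => LinearMap.sumKerInfRange_eq_bot hn⟩,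
    ⟨n, fun _ => LinearMap.sumKerInfRange_eq_top hn⟩,
    fun _ _ => LinearMap.apply_mem_sumKerInfRange, fun r => ⟨fun x hx => ?_,
      fun _ _ => LinearMap.mem_sumKerInfRange_of_pow_apply_mem, fun y hy => ?_⟩⟩
  · convert LinearMap.pow_apply_mem_sumKerInfRange_sub hx r using 2
    ring
  · obtain ⟨x, hx, rfl⟩ := LinearMap.sumKerInfRange_neg_le_map r hy
    refine ⟨x, hx, ?_⟩
    rw [sub_self]
    exact zero_mem _
end

section
/- Let F be a field, V a finite-dimensional F-vector space, and N : V → V a nilpotent F-linear endomorphism. If (M_r)_{r∈ℤ} and (M'_r)_{r∈ℤ} are both monodromy filtrations for N, then M_r = M'_r for every integer r (the monodromy filtration of a nilpotent endomorphism is unique). -/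
namespace IsMonodromyFiltration

variable {F V : Type*} [Field F] [AddCommGroup V] [Module F V]
  {N : V →ₗ[F] V} {M M' : ℤ → Submodule F V}

theorem monotone (hM : IsMonodromyFiltration N M) : Monotone M :=
  monotone_int_of_le_succ hM.1

theorem pow_apply_mem (hM : IsMonodromyFiltration N M) (m : ℕ) {r : ℤ} {x : V} (hx : x ∈ M r) :
    (N ^ m) x ∈ M (r - 2 * m) := by
  induction m with
  | zero => simpa using hx
  | succ m ih =>
    rw [pow_succ', Module.End.mul_apply]
    have h := hM.2.2.2.1 _ _ ih
    rwa [show r - 2 * (m : ℤ) - 2 = r - 2 * ((m + 1 : ℕ) : ℤ) by push_cast; ring] at h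

/-- The kernel of `N ^ (k + 1)` lies in the `k`-th step of a monodromy filtration. -/
theorem mem_of_pow_apply_eq_zero (hM : IsMonodromyFiltration N M) {k : ℕ} {x : V}
    (hx : (N ^ (k + 1)) x = 0) : x ∈ M k := by
  obtain ⟨b, hb⟩ := hM.2.2.1
  have descend : ∀ n : ℕ, x ∈ M ((k + n : ℕ) : ℤ) → x ∈ M k := by
    intro n
    induction n with
    | zero => exact id
    | succ n ih =>
      intro h
      apply ih
      have hz : (N ^ (k + (n + 1))) x = 0 := by
        rw [show k + (n + 1) = n + (k + 1) by ring, pow_add, Module.End.mul_apply, hx, map_zero]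
      have h' := (hM.2.2.2.2 (k + (n + 1))).2.1 x h (by rw [hz]; exact zero_mem _)
      rwa [show ((k + (n + 1) : ℕ) : ℤ) - 1 = ((k + n : ℕ) : ℤ) by push_cast; ring] at h'
  refine descend b.toNat ?_
  rw [hb _ (by omega)]
  exact Submodule.mem_top

/-- Every element of `M s` lies in `N ^ m (M (s + 2 * m))` as long as `s + m ≤ 0`. -/
theorem exists_pow_apply_eq (hM : IsMonodromyFiltration N M) {m : ℕ} {s : ℤ} (hs : s + m ≤ 0)
    {y : V} (hy : y ∈ M s) : ∃ x ∈ M (s + 2 * m), (N ^ m) x = y := by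
  obtain ⟨a, ha⟩ := hM.2.1
  obtain hsa | has := le_total s a
  · rw [ha s hsa, Submodule.mem_bot] at hy
    exact ⟨0, zero_mem _, by rw [hy, map_zero]⟩
  induction s, has using Int.leInduction generalizing y with
  | base =>
    rw [ha a le_rfl, Submodule.mem_bot] at hy
    exact ⟨0, zero_mem _, by rw [hy, map_zero]⟩
  | succ s _ ih =>
    obtain ⟨l, hl⟩ : ∃ l : ℕ, s + 1 = -((m + l : ℕ) : ℤ) := ⟨(-(s + 1) - m).toNat, by omega⟩
    obtain ⟨x, hx, hxy⟩ := (hM.2.2.2.2 (m + l)).2.2 y (hl ▸ hy)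
    rw [show -((m + l : ℕ) : ℤ) - 1 = s by omega] at hxy
    obtain ⟨w, hw, hwy⟩ := ih (by omega) hxy
    refine ⟨(N ^ l) x - w, sub_mem ?_ (hM.monotone (by omega) hw), ?_⟩
    · exact hM.monotone (by omega) (hM.pow_apply_mem l hx)
    · rw [map_sub, hwy, ← Module.End.mul_apply, ← pow_add, sub_sub_cancel]

theorem le (hM : IsMonodromyFiltration N M) (hM' : IsMonodromyFiltration N M') : M ≤ M' := by
  obtain ⟨b, hb⟩ := hM'.2.2.1
  have key : ∀ (n : ℕ) (r : ℤ), b - 2 * n ≤ r → M r ≤ M' r := by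
    intro n
    induction n with
    | zero =>
      intro r hr
      rw [hb r (by simpa using hr)]
      exact le_top
    | succ n ih =>
      intro r hr x hx
      have image_mem : ∀ u ∈ M (r + 2), N u ∈ M' r := fun u hu => by
        have h := hM'.2.2.2.1 _ _ (ih (r + 2) (by push_cast at hr; omega) hu)
        rwa [add_sub_cancel_right] at h
      obtain hneg | hpos := lt_or_ge r 0
      · obtain ⟨u, hu, rfl⟩ := hM.exists_pow_apply_eq (m := 1) (by push_cast; omega) hx
        rw [pow_one]
        exact image_mem u (by simpa using hu)
      · lift r to ℕ using hpos
        have hy := hM.pow_apply_mem (r + 1) hx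
        obtain ⟨u, hu, huy⟩ :=
          hM.exists_pow_apply_eq (m := r + 2) (by push_cast; omega) hy
        have hker : x - N u ∈ M' r := by
          apply hM'.mem_of_pow_apply_eq_zero
          rw [map_sub, ← huy, pow_succ N (r + 1), Module.End.mul_apply, sub_self]
        have hNu := image_mem u (hM.monotone (by push_cast; omega) hu)
        simpa using add_mem hker hNu
  exact fun r => key (b - r).toNat r (by omega)

end IsMonodromyFiltration


/-- **Uniqueness of the monodromy filtration.** Two monodromy filtrations for the same nilpotent
endomorphism `N` of a finite-dimensional vector space coincide. -/
theorem monodromyFiltration_unique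
    (F V : Type*) [Field F] [AddCommGroup V] [Module F V] [FiniteDimensional F V]
    (N : V →ₗ[F] V) (hN : IsNilpotent N) (M M' : ℤ → Submodule F V)
    (hM : IsMonodromyFiltration N M) (hM' : IsMonodromyFiltration N M') :
    ∀ r : ℤ, M r = M' r := by
  exact fun r => le_antisymm (hM.le hM' r) (hM'.le hM r)
end

section
/- Let p be a prime, K a field of characteristic zero, and ζ ∈ K a primitive p-th root of unity. For 0 ≤ i ≤ p−1 set a_i = Σ_{j=0}^{i−1} ζ^j and let G_p(X) = Π_{i=0}^{p−1} (X − a_i) ∈ K[X]. Then G_p(ζX + 1) = G_p(X), i.e., the composition of G_p with the polynomial ζX + 1 equals G_p. -/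
open Polynomial in
/-- Let `p` be a prime, `K` a field of characteristic zero and `ζ ∈ K` a primitive `p`-th root
of unity. With `a i = ∑_{j < i} ζ ^ j` and `G = ∏_{i < p} (X - a i)`, one has
`G (ζ X + 1) = G (X)`. -/
theorem Gp_comp_zeta_X_add_one
    (p : ℕ) (hp : p.Prime) (K : Type*) [Field K] [CharZero K]
    (ζ : K) (hζ : IsPrimitiveRoot ζ p)
    (a : ℕ → K) (ha : ∀ i, a i = ∑ j ∈ Finset.range i, ζ ^ j)
    (G : K[X]) (hG : G = ∏ i ∈ Finset.range p, (X - C (a i))) :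
    G.comp (C ζ * X + 1) = G := by
  have hap : a p = a 0 := by
    rw [ha, ha, hζ.geom_sum_eq_zero hp.one_lt, Finset.sum_range_zero]
  have hshift (f : K → K[X]) :
      ∏ i ∈ Finset.range p, f (a i) = ∏ i ∈ Finset.range p, f (a (i + 1)) := by
    obtain ⟨n, rfl⟩ := Nat.exists_eq_succ_of_ne_zero hp.ne_zero
    rw [Finset.prod_range_succ', Finset.prod_range_succ, ← hap]
  have hfactor (i : ℕ) : C ζ * X + 1 - C (a (i + 1)) = C ζ * (X - C (a i)) := by
    rw [ha, ha, geom_sum_succ, C_add, C_mul, C_1]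
    ring
  have hcomp : G.comp (C ζ * X + 1) = ∏ i ∈ Finset.range p, (C ζ * X + 1 - C (a i)) := by
    simp [hG, prod_comp]
  rw [hcomp, hshift (fun x => C ζ * X + 1 - C x), Finset.prod_congr rfl fun i _ => hfactor i,
    Finset.prod_mul_distrib, Finset.prod_const, Finset.card_range, ← C_pow, hζ.pow_eq_one,
    C_1, one_mul, hG]
end
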